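/- arXiv:2412.14709 — 2 statements merged into one kernel-verified Lean document; each statement's English description precedes it below -/
import Mathlib

section
/- The quaternary ℤ₂-lattice 𝔸 ⊥ 2𝔸 is not primitively represented by ℍ³ ⊥ ⟨1, −1⟩. -/
open Matrix

/-- Primitive representation: `T` with `Tᵀ H T = G` whose image is a direct summand
(equivalently `T` has a left inverse). -/
def PrimRep {R : Type*} [CommRing R] {ι κ : Type*} [Fintype ι] [Fintype κ] [DecidableEq κ]
    (G : Matrix κ κ R) (H : Matrix ι ι R) : Prop :=
  ∃ T : Matrix ι κ R, Tᵀ * H * T = G ∧ ∃ P : Matrix κ ι R, P * T = 1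

/-- The Gram matrix of the orthogonal sum of `n` hyperbolic planes `ℍⁿ`. -/
def HypN (R : Type*) [CommRing R] (n : ℕ) :
    Matrix (Fin n × Fin 2) (Fin n × Fin 2) R := fun p q =>
  if p.1 = q.1 ∧ p.2 ≠ q.2 then 1 else 0

/-- The Gram matrix of `ℍ³ ⊥ ⟨1, -1⟩` over `ℤ₂`. -/
noncomputable def L8 : Matrix ((Fin 3 × Fin 2) ⊕ Fin 2) ((Fin 3 × Fin 2) ⊕ Fin 2) ℤ_[2] :=
  Matrix.fromBlocks (HypN ℤ_[2] 3) 0 0 !![1, 0; 0, -1]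

/-- The Gram matrix of `𝔸 ⊥ 2𝔸` over `ℤ₂`. -/
noncomputable def A2A : Matrix (Fin 4) (Fin 4) ℤ_[2] :=
  !![2, 1, 0, 0; 1, 2, 0, 0; 0, 0, 4, 2; 0, 0, 2, 4]

set_option synthInstance.maxSize 1000 in
set_option synthInstance.maxHeartbeats 100000 in
/-- In the hyperbolic quadratic space of dimension `4` over `𝔽₂`, the orthogonal complement of an
anisotropic plane is anisotropic. -/
theorem eq_zero_of_orthogonal_anisotropic_plane_dim_four :
    ∀ p q r s : ZMod 2, p * q + r * s = 1 → ∀ p' q' r' s' : ZMod 2, p' * q' + r' * s' = 1 →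
      p * q' + q * p' + r * s' + s * r' = 1 → ∀ a b c d : ZMod 2, a * b + c * d = 0 →
      a * q + b * p + c * s + d * r = 0 → a * q' + b * p' + c * s' + d * r' = 0 →
      a = 0 ∧ b = 0 ∧ c = 0 ∧ d = 0 := by
  decide +kernel

/-- In the hyperbolic quadratic space of dimension `6` over `𝔽₂`, with coordinates grouped in
hyperbolic pairs, let `w` and `w'` span a totally singular subspace orthogonal to an anisotropic
plane. If the first coordinate of `w` is `1`, then `w'` is a multiple of `w`. -/
theorem singular_proportional_of_coord_eq_one {b c d e f a' b' c' d' e' f' : ZMod 2}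
    {p q r s t u p' q' r' s' t' u' : ZMod 2}
    (hu : p * q + r * s + t * u = 1) (hu' : p' * q' + r' * s' + t' * u' = 1)
    (huu : p * q' + q * p' + (r * s' + s * r') + (t * u' + u * t') = 1)
    (hw : 1 * b + c * d + e * f = 0) (hw' : a' * b' + c' * d' + e' * f' = 0)
    (hww : 1 * b' + b * a' + (c * d' + d * c') + (e * f' + f * e') = 0)
    (hwu : 1 * q + b * p + (c * s + d * r) + (e * u + f * t) = 0)
    (hwu' : 1 * q' + b * p' + (c * s' + d * r') + (e * u' + f * t') = 0)
    (hw'u : a' * q + b' * p + (c' * s + d' * r) + (e' * u + f' * t) = 0)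
    (hw'u' : a' * q' + b' * p' + (c' * s' + d' * r') + (e' * u' + f' * t') = 0) :
    b' = a' * b ∧ c' = a' * c ∧ d' = a' * d ∧ e' = a' * e ∧ f' = a' * f := by
  obtain ⟨h₁, h₂, h₃, h₄⟩ := eq_zero_of_orthogonal_anisotropic_plane_dim_four
    (r - p * c) (s - p * d) (t - p * e) (u - p * f)
    (by linear_combination hu - p * hwu + p ^ 2 * hw)
    (r' - p' * c) (s' - p' * d) (t' - p' * e) (u' - p' * f)
    (by linear_combination hu' - p' * hwu' + p' ^ 2 * hw)
    (by linear_combination huu - p' * hwu - p * hwu' + 2 * p * p' * hw)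
    (c' - a' * c) (d' - a' * d) (e' - a' * e) (f' - a' * f)
    (by linear_combination hw' - a' * hww + a' ^ 2 * hw)
    (by linear_combination hw'u - a' * hwu - p * hww + 2 * a' * p * hw)
    (by linear_combination hw'u' - a' * hwu' - p' * hww + 2 * a' * p' * hw)
  refine ⟨?_, sub_eq_zero.mp h₁, sub_eq_zero.mp h₂, sub_eq_zero.mp h₃, sub_eq_zero.mp h₄⟩
  linear_combination hww - 2 * a' * hw - c * h₂ - d * h₁ - e * h₄ - f * h₃

/-- In the hyperbolic quadratic space of dimension `6` over `𝔽₂`, a totally singular subspace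
orthogonal to an anisotropic plane has dimension at most `1`. -/
theorem singular_dependent_of_orthogonal_anisotropic_plane
    {w w' u u' : Fin 3 → Fin 2 → ZMod 2}
    (hu : ∑ i, u i 0 * u i 1 = 1) (hu' : ∑ i, u' i 0 * u' i 1 = 1)
    (huu : ∑ i, (u i 0 * u' i 1 + u i 1 * u' i 0) = 1)
    (hw : ∑ i, w i 0 * w i 1 = 0) (hw' : ∑ i, w' i 0 * w' i 1 = 0)
    (hww : ∑ i, (w i 0 * w' i 1 + w i 1 * w' i 0) = 0)
    (hwu : ∑ i, (w i 0 * u i 1 + w i 1 * u i 0) = 0)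
    (hwu' : ∑ i, (w i 0 * u' i 1 + w i 1 * u' i 0) = 0)
    (hw'u : ∑ i, (w' i 0 * u i 1 + w' i 1 * u i 0) = 0)
    (hw'u' : ∑ i, (w' i 0 * u' i 1 + w' i 1 * u' i 0) = 0) :
    w = 0 ∨ ∃ t : ZMod 2, w' = t • w := by
  refine or_iff_not_imp_left.mpr fun hne ↦ ?_
  obtain ⟨i, hi⟩ := Function.ne_iff.mp hne
  obtain ⟨k, hk⟩ := Function.ne_iff.mp hi
  have hone : w i k = 1 := Fin.eq_one_of_ne_zero _ hk
  obtain ⟨σ, rfl⟩ : ∃ σ : Equiv.Perm (Fin 3), σ 0 = i := ⟨Equiv.swap 0 i, Equiv.swap_apply_left 0 i⟩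
  obtain ⟨τ, rfl⟩ : ∃ τ : Equiv.Perm (Fin 2), τ 0 = k := ⟨Equiv.swap 0 k, Equiv.swap_apply_left 0 k⟩
  have quad (v : Fin 3 → Fin 2 → ZMod 2) : ∑ i, v i 0 * v i 1 =
      v (σ 0) (τ 0) * v (σ 0) (τ 1) + v (σ 1) (τ 0) * v (σ 1) (τ 1) +
        v (σ 2) (τ 0) * v (σ 2) (τ 1) := by
    rw [← Equiv.sum_comp σ, Fin.sum_univ_three]
    have h (j) : v j 0 * v j 1 = v j (τ 0) * v j (τ 1) := by
      rw [← Fin.prod_univ_two (v j), ← Equiv.prod_comp τ, Fin.prod_univ_two]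
    simp only [h]
  have bilin (v v' : Fin 3 → Fin 2 → ZMod 2) : ∑ i, (v i 0 * v' i 1 + v i 1 * v' i 0) =
      v (σ 0) (τ 0) * v' (σ 0) (τ 1) + v (σ 0) (τ 1) * v' (σ 0) (τ 0) +
        (v (σ 1) (τ 0) * v' (σ 1) (τ 1) + v (σ 1) (τ 1) * v' (σ 1) (τ 0)) +
        (v (σ 2) (τ 0) * v' (σ 2) (τ 1) + v (σ 2) (τ 1) * v' (σ 2) (τ 0)) := by
    have h (v v' : Fin 3 → Fin 2 → ZMod 2) :
        ∑ i, (v i 0 * v' i 1 + v i 1 * v' i 0) =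
        ∑ i, (v + v') i 0 * (v + v') i 1 - ∑ i, v i 0 * v i 1 - ∑ i, v' i 0 * v' i 1 := by
      simp only [← Finset.sum_sub_distrib]
      exact Finset.sum_congr rfl fun i _ ↦ by simp only [Pi.add_apply]; ring
    rw [h, quad, quad, quad]
    simp only [Pi.add_apply]
    ring
  rw [quad] at hu hu' hw hw'
  rw [bilin] at huu hww hwu hwu' hw'u hw'u'
  rw [hone] at hw hww hwu hwu'
  obtain ⟨h₁, h₂, h₃, h₄, h₅⟩ :=
    singular_proportional_of_coord_eq_one hu hu' huu hw hw' hww hwu hwu' hw'u hw'u'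
  refine ⟨w' (σ 0) (τ 0), funext fun i ↦ funext fun k ↦ ?_⟩
  obtain ⟨i, rfl⟩ := σ.surjective i
  obtain ⟨k, rfl⟩ := τ.surjective k
  fin_cases i <;> fin_cases k <;> simp_all

/-- The Gram matrix of a tuple of vectors of `ℍ³ ⊥ ⟨1, -1⟩`. -/
theorem transpose_mul_L8_mul_apply {κ : Type*}
    (T : Matrix ((Fin 3 × Fin 2) ⊕ Fin 2) κ ℤ_[2]) (i j : κ) :
    (Tᵀ * L8 * T) i j =
      ∑ k, (T (.inl (k, 0)) i * T (.inl (k, 1)) j + T (.inl (k, 1)) i * T (.inl (k, 0)) j) +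
        T (.inr 0) i * T (.inr 0) j - T (.inr 1) i * T (.inr 1) j := by
  simp [Matrix.mul_apply, Fintype.sum_prod_type, Fin.sum_univ_succ, L8, HypN]
  ring

theorem PadicInt.toZMod_eq_zero_iff_dvd {p : ℕ} [Fact p.Prime] (x : ℤ_[p]) :
    PadicInt.toZMod x = 0 ↔ (p : ℤ_[p]) ∣ x := by
  rw [← RingHom.mem_ker, PadicInt.ker_toZMod, PadicInt.maximalIdeal_eq_span_p,
    Ideal.mem_span_singleton]

/-- The quaternary `ℤ₂`-lattice `𝔸 ⊥ 2𝔸` is not primitively represented by `ℍ³ ⊥ ⟨1,-1⟩`. -/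
theorem A2A_not_primitively_represented_by_L8 : ¬ PrimRep A2A L8 := by
  rintro ⟨T, hT, P, hP⟩
  have dvd_iff (x : ℤ_[2]) : PadicInt.toZMod x = 0 ↔ 2 ∣ x := by
    simpa using PadicInt.toZMod_eq_zero_iff_dvd x
  have htwo : PadicInt.toZMod (2 : ℤ_[2]) = 0 := (dvd_iff 2).mpr dvd_rfl
  have two_prime : Prime (2 : ℤ_[2]) := by simpa using PadicInt.prime_p (p := 2)
  have two_ne : (2 : ℤ_[2]) ≠ 0 := two_prime.ne_zero
  have gram (i j : Fin 4) :
      ∑ k, (T (.inl (k, 0)) i * T (.inl (k, 1)) j + T (.inl (k, 1)) i * T (.inl (k, 0)) j) +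
        T (.inr 0) i * T (.inr 0) j - T (.inr 1) i * T (.inr 1) j = A2A i j := by
    rw [← hT, transpose_mul_L8_mul_apply]
  -- Every vector of the image has even norm, so its last two coordinates are congruent mod `2`.
  have hdiag (i : Fin 4) : ∃ n, A2A i i = 2 * n := by
    fin_cases i
    exacts [⟨1, by simp [A2A]⟩, ⟨1, by simp [A2A]⟩, ⟨2, by simp [A2A]; norm_num⟩,
      ⟨2, by simp [A2A]; norm_num⟩]
  have hcong (i : Fin 4) : ∃ c, T (.inr 0) i = T (.inr 1) i + 2 * c := by
    obtain ⟨n, hn⟩ := hdiag i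
    have h := gram i i
    have hmul : 2 ∣ (T (.inr 0) i - T (.inr 1) i) * (T (.inr 0) i - T (.inr 1) i) :=
      ⟨n - ∑ k, T (.inl (k, 0)) i * T (.inl (k, 1)) i
        - T (.inr 1) i * (T (.inr 0) i - T (.inr 1) i), by
        rw [hn] at h
        simp only [Fin.sum_univ_three] at h ⊢
        linear_combination h⟩
    obtain ⟨c, hc⟩ := (two_prime.dvd_or_dvd hmul).elim id id
    exact ⟨c, by linear_combination hc⟩
  choose c hc using hcong
  let w (j : Fin 4) (i : Fin 3) (k : Fin 2) : ZMod 2 := PadicInt.toZMod (T (.inl (i, k)) j)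
  have quad (j : Fin 4) (n : ℤ_[2]) (hn : A2A j j = 2 * n) :
      ∑ i, w j i 0 * w j i 1 = PadicInt.toZMod n := by
    have h := gram j j
    rw [hn, hc j] at h
    have norm_eq : n = ∑ i, T (.inl (i, 0)) j * T (.inl (i, 1)) j +
        2 * (c j * (T (.inr 1) j + c j)) := by
      refine mul_left_cancel₀ two_ne ?_
      simp only [Fin.sum_univ_three] at h ⊢
      linear_combination -h
    simp [norm_eq, w, htwo]
  have bilin (j l : Fin 4) :
      ∑ i, (w j i 0 * w l i 1 + w j i 1 * w l i 0) = PadicInt.toZMod (A2A j l) := by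
    have inner_eq : A2A j l =
        ∑ i, (T (.inl (i, 0)) j * T (.inl (i, 1)) l + T (.inl (i, 1)) j * T (.inl (i, 0)) l) +
        2 * (c j * T (.inr 1) l + c l * T (.inr 1) j + 2 * c j * c l) := by
      rw [← gram, hc j, hc l]
      ring
    simp [inner_eq, w, htwo]
  -- A combination of the last two vectors that vanishes mod `2` on `ℍ³` has even coefficients.
  have even_coeffs (x y : ℤ_[2])
      (hxy : ∀ i k, PadicInt.toZMod (T (.inl (i, k)) 2 * x + T (.inl (i, k)) 3 * y) = 0) :
      PadicInt.toZMod x = 0 ∧ PadicInt.toZMod y = 0 := by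
    have h (i k) : ∃ z, T (.inl (i, k)) 2 * x + T (.inl (i, k)) 3 * y = 2 * z :=
      (dvd_iff _).mp (hxy i k)
    choose z hz using h
    obtain ⟨b, hb⟩ : ∃ b, T (.inr 1) 2 * x + T (.inr 1) 3 * y = b := ⟨_, rfl⟩
    obtain ⟨d, hd⟩ : ∃ d, c 2 * x + c 3 * y = d := ⟨_, rfl⟩
    have norm_eq : x * x + x * y + y * y = d * (b + d) + 2 * ∑ i, z i 0 * z i 1 := by
      have h₂ := gram 2 2
      have h₃ := gram 3 3
      have h₂₃ := gram 2 3
      simp only [hc, Fin.sum_univ_three] at h₂ h₃ h₂₃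
      simp only [A2A, Matrix.of_apply, Matrix.cons_val] at h₂ h₃ h₂₃
      refine mul_left_cancel₀ two_ne (mul_left_cancel₀ two_ne ?_)
      have hprod (i) : 2 * (2 * (z i 0 * z i 1)) =
          (T (.inl (i, 0)) 2 * x + T (.inl (i, 0)) 3 * y) *
            (T (.inl (i, 1)) 2 * x + T (.inl (i, 1)) 3 * y) := by
        rw [hz, hz]
        ring
      rw [Fin.sum_univ_three, ← hb, ← hd]
      linear_combination -x ^ 2 * h₂ - y ^ 2 * h₃ - 2 * x * y * h₂₃ -
        2 * hprod 0 - 2 * hprod 1 - 2 * hprod 2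
    have parity : ∀ x y b d : ZMod 2, x * x + x * y + y * y = d * (b + d) →
        b = 0 ∨ x = 0 ∧ y = 0 := by decide
    refine (parity _ _ (PadicInt.toZMod b) (PadicInt.toZMod d) ?_).elim (fun hb₀ ↦ ?_) id
    · simpa [htwo] using congrArg PadicInt.toZMod norm_eq
    have hall (s) : PadicInt.toZMod (T s 2 * x + T s 3 * y) = 0 := by
      have h₁ : PadicInt.toZMod (T (.inr 1) 2 * x + T (.inr 1) 3 * y) = 0 := by rw [hb, hb₀]
      have h₀ : T (.inr 0) 2 * x + T (.inr 0) 3 * y =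
          T (.inr 1) 2 * x + T (.inr 1) 3 * y + 2 * d := by
        rw [hc, hc, ← hd]
        ring
      match s with
      | .inl (i, k) => exact hxy i k
      | .inr 0 => rw [h₀, map_add, h₁, map_mul, htwo, zero_mul, add_zero]
      | .inr 1 => exact h₁
    have hcomb (l : Fin 4) : PadicInt.toZMod ((P * T) l 2 * x + (P * T) l 3 * y) = 0 := by
      have : (P * T) l 2 * x + (P * T) l 3 * y = ∑ s, P l s * (T s 2 * x + T s 3 * y) := by
        simp only [Matrix.mul_apply, Finset.sum_mul, ← Finset.sum_add_distrib]
        exact Finset.sum_congr rfl fun s _ ↦ by ring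
      rw [this, map_sum]
      exact Finset.sum_eq_zero fun s _ ↦ by rw [map_mul, hall, mul_zero]
    exact ⟨by simpa [hP] using hcomb 2, by simpa [hP] using hcomb 3⟩
  have dep : w 2 = 0 ∨ ∃ t : ZMod 2, w 3 = t • w 2 := by
    apply singular_dependent_of_orthogonal_anisotropic_plane (u := w 0) (u' := w 1)
    · rw [quad 0 1 (by simp [A2A]), map_one]
    · rw [quad 1 1 (by simp [A2A]), map_one]
    · simp [bilin, A2A]
    · rw [quad 2 2 (by simp [A2A]; norm_num), htwo]
    · rw [quad 3 2 (by simp [A2A]; norm_num), htwo]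
    · simp [bilin, A2A, htwo]
    all_goals simp [bilin, A2A]
  obtain h | ⟨t, h⟩ := dep
  · have hw (i k) : PadicInt.toZMod (T (.inl (i, k)) 2) = 0 := congrFun₂ h i k
    simpa using (even_coeffs 1 0 (by simp [hw])).1
  · have hw (i k) : PadicInt.toZMod (T (.inl (i, k)) 3) =
        t * PadicInt.toZMod (T (.inl (i, k)) 2) := congrFun₂ h i k
    obtain ⟨x, rfl⟩ := ZMod.ringHom_surjective PadicInt.toZMod t
    have := (even_coeffs (-x) 1 fun i k ↦ by
      rw [map_add, map_mul, map_mul, hw, map_neg, map_one]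
      ring).2
    simp at this
end

section
/- Let M = M₁ ⊥ ⋯ ⊥ M_r be a Jordan splitting of a ℤ₂-lattice M with ℤ₂ ⊇ sM₁ ⊋ ⋯ ⊋ sM_r = nM_r = 2^{2s}ℤ₂ for some positive integer s, such that the ℚ₂-space of M is isometric to that of 𝔸 ⊥ ⟨1,−1⟩ and M' = M₁ ⊥ ⋯ ⊥ M_{r−1} is anisotropic. Then no integer congruent to 2^{2s+2} modulo 2^{2s+3} is primitively represented by M. -/
open Matrix

theorem PadicInt.isUnit_iff_toZMod_eq_one {z : ℤ_[2]} :
    IsUnit z ↔ PadicInt.toZMod z = 1 := by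
  have h : PadicInt.toZMod z = 0 ↔ ¬ IsUnit z := by
    rw [← RingHom.mem_ker, PadicInt.ker_toZMod, IsLocalRing.mem_maximalIdeal, mem_nonunits_iff]
  have hc : ∀ c : ZMod 2, c = 1 ↔ ¬ c = 0 := by decide
  rw [hc, h, not_not]

theorem PadicInt.toZMod_two_eq_zero : PadicInt.toZMod (2 : ℤ_[2]) = 0 := by
  rw [map_ofNat]
  rfl

theorem PadicInt.exists_two_mul_of_not_isUnit {z : ℤ_[2]} (hz : ¬ IsUnit z) :
    ∃ w, z = 2 * w := by
  have h := PadicInt.mem_nonunits.1 (mem_nonunits_iff.2 hz)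
  obtain ⟨w, hw⟩ := (PadicInt.norm_lt_one_iff_dvd z).1 h
  exact ⟨w, by simpa using hw⟩

theorem Padic.norm_sq_ne_half (x : ℚ_[2]) : ‖x‖ ^ 2 ≠ 1 / 2 := by
  intro h
  have hx : x ≠ 0 := by
    rintro rfl
    norm_num at h
  rw [Padic.norm_eq_zpow_neg_valuation hx, ← zpow_natCast, ← _root_.zpow_mul] at h
  have h' : ((2 : ℕ) : ℝ) ^ (-x.valuation * ((2 : ℕ) : ℤ)) = ((2 : ℕ) : ℝ) ^ (-1 : ℤ) := by
    rw [h]; norm_num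
  have := zpow_right_injective₀ (a := ((2 : ℕ) : ℝ)) (by norm_num) (by norm_num) h'
  omega

/-- A binary quadratic form over `ℤ₂` with all coefficients odd is anisotropic over `ℚ₂`, and the
norms of its values are squares of norms. -/
theorem Padic.exists_norm_odd_form_eq {u₀ u₁ u₂ : ℤ_[2]} (h₀ : IsUnit u₀) (h₁ : IsUnit u₁)
    (h₂ : IsUnit u₂) (p q : ℚ_[2]) :
    ∃ r : ℚ_[2], ‖(u₀ : ℚ_[2]) * p ^ 2 + u₁ * (p * q) + u₂ * q ^ 2‖ = ‖r‖ ^ 2 ∧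
      (r = 0 → p = 0 ∧ q = 0) := by
  wlog hpq : ‖p‖ ≤ ‖q‖ generalizing u₀ u₂ p q
  · obtain ⟨r, hr, hr'⟩ := this h₂ h₀ q p (le_of_not_ge hpq)
    refine ⟨r, ?_, fun h => (hr' h).symm⟩
    rw [← hr]
    congr 1
    ring
  by_cases hq : q = 0
  · subst hq
    have hp : p = 0 := by simpa using hpq
    exact ⟨0, by simp [hp], fun _ => ⟨hp, rfl⟩⟩
  refine ⟨q, ?_, fun h => absurd h hq⟩
  obtain ⟨t, ht⟩ : ∃ t : ℤ_[2], p = t * q := by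
    refine ⟨⟨p / q, ?_⟩, (div_mul_cancel₀ p hq).symm⟩
    rw [norm_div]
    exact div_le_one_of_le₀ hpq (norm_nonneg _)
  have hodd : IsUnit (u₀ * t ^ 2 + u₁ * t + u₂) := by
    rw [PadicInt.isUnit_iff_toZMod_eq_one] at *
    simp only [map_add, map_mul, map_pow, h₀, h₁, h₂]
    generalize PadicInt.toZMod t = c
    revert c
    decide
  have hfac : (u₀ : ℚ_[2]) * p ^ 2 + u₁ * (p * q) + u₂ * q ^ 2 =
      ((u₀ * t ^ 2 + u₁ * t + u₂ : ℤ_[2]) : ℚ_[2]) * q ^ 2 := by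
    rw [ht]
    push_cast
    ring
  rw [hfac, norm_mul, ← PadicInt.norm_def, PadicInt.isUnit_iff.1 hodd, norm_pow, one_mul]

/-- The bilinear form of `𝔸 ⊥ ⟨1, -1⟩`. -/
theorem dotProduct_mulVec_A_perp_hyperbolic (x y : Fin 4 → ℚ_[2]) :
    x ⬝ᵥ (!![2, 1, 0, 0; 1, 2, 0, 0; 0, 0, 1, 0; 0, 0, 0, -1] : Matrix _ _ ℚ_[2]) *ᵥ y =
      2 * x 0 * y 0 + x 0 * y 1 + x 1 * y 0 + 2 * x 1 * y 1 + x 2 * y 2 - x 3 * y 3 := by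
  simp [dotProduct, mulVec, Fin.sum_univ_four]
  ring

/-- The space `𝔸 ⊥ ⟨1, -1⟩` contains no plane isometric to a scaling by an even power of two of
a binary form with all coefficients odd. -/
theorem not_odd_plane_in_A_perp_hyperbolic (s : ℕ) {u₀ u₁ u₂ : ℤ_[2]} (h₀ : IsUnit u₀)
    (h₁ : IsUnit u₁) (h₂ : IsUnit u₂) (x y : Fin 4 → ℚ_[2])
    (hxx : x ⬝ᵥ (!![2, 1, 0, 0; 1, 2, 0, 0; 0, 0, 1, 0; 0, 0, 0, -1] : Matrix _ _ ℚ_[2]) *ᵥ x =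
      2 ^ (2 * s) * u₀)
    (hxy : x ⬝ᵥ (!![2, 1, 0, 0; 1, 2, 0, 0; 0, 0, 1, 0; 0, 0, 0, -1] : Matrix _ _ ℚ_[2]) *ᵥ y =
      2 ^ (2 * s) * u₁)
    (hyy : y ⬝ᵥ (!![2, 1, 0, 0; 1, 2, 0, 0; 0, 0, 1, 0; 0, 0, 0, -1] : Matrix _ _ ℚ_[2]) *ᵥ y =
      2 ^ (2 * s + 2) * u₂) : False := by
  rw [dotProduct_mulVec_A_perp_hyperbolic] at hxx hxy hyy
  obtain ⟨p, q, hpq, hne⟩ : ∃ p q : ℚ_[2],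
      p * (x 2 - x 3) + q * (y 2 - y 3) = 0 ∧ ¬ (p = 0 ∧ q = 0) := by
    by_cases hx : x 2 - x 3 = 0
    · exact ⟨1, 0, by simp [hx], by simp⟩
    · exact ⟨y 2 - y 3, -(x 2 - x 3), by ring, fun h => hx (neg_eq_zero.1 h.2)⟩
  obtain ⟨r, hr, hr0⟩ := Padic.exists_norm_odd_form_eq h₀ h₁ h₂ p (2 * q)
  obtain ⟨t, ht, -⟩ := Padic.exists_norm_odd_form_eq (u₀ := 1) (u₁ := 1) (u₂ := 1)
    isUnit_one isUnit_one isUnit_one (p * x 0 + q * y 0) (p * x 1 + q * y 1)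
  have hval : (2 ^ s) ^ 2 * ((u₀ : ℚ_[2]) * p ^ 2 + u₁ * (p * (2 * q)) + u₂ * (2 * q) ^ 2) =
      2 * (((1 : ℤ_[2]) : ℚ_[2]) * (p * x 0 + q * y 0) ^ 2 +
        ((1 : ℤ_[2]) : ℚ_[2]) * ((p * x 0 + q * y 0) * (p * x 1 + q * y 1)) +
        ((1 : ℤ_[2]) : ℚ_[2]) * (p * x 1 + q * y 1) ^ 2) := by
    rw [PadicInt.coe_one]
    linear_combination (-p ^ 2) * hxx - 2 * p * q * hxy - q ^ 2 * hyy +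
      (p * (x 2 + x 3) + q * (y 2 + y 3)) * hpq
  have hnorm := congrArg norm hval
  have h2 : ‖(2 : ℚ_[2])‖ = 1 / 2 := by
    simpa using Padic.norm_p (p := 2)
  rw [norm_mul, norm_mul, hr, ht, norm_pow, ← mul_pow, ← norm_mul, h2] at hnorm
  have hr' : r ≠ 0 := fun h => hne (by simpa using hr0 h)
  have hR : ‖2 ^ s * r‖ ≠ 0 := by simp [hr']
  have ht' : ‖t‖ ≠ 0 := by
    intro h
    rw [h] at hnorm
    apply hR
    simpa using hnorm
  apply Padic.norm_sq_ne_half (2 ^ s * r / t)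
  rw [norm_div, div_pow, hnorm]
  field_simp

theorem PadicInt.exists_root_quadratic {b : ℤ_[2]} (hb : IsUnit b) (c d : ℤ_[2]) :
    ∃ t : ℤ_[2], d + t * b + 2 * t ^ 2 * c = 0 := by
  obtain ⟨b', hb'⟩ := hb.exists_right_inv
  have hderiv : IsUnit (4 * c * (-(d * b')) + b) := by
    rw [PadicInt.isUnit_iff_toZMod_eq_one] at *
    have h4 : (4 : ℤ_[2]) = 2 * 2 := by norm_num
    rw [h4]
    simp [PadicInt.toZMod_two_eq_zero, hb]
  have hvalue : ‖2 * c * (d * b') ^ 2‖ < 1 := by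
    rw [PadicInt.norm_lt_one_iff_dvd]
    exact ⟨c * (d * b') ^ 2, by push_cast; ring⟩
  obtain ⟨z, hz, -⟩ := hensels_lemma (p := 2)
    (F := Polynomial.C (2 : ℤ_[2]) * Polynomial.C c * Polynomial.X ^ 2 +
      Polynomial.C b * Polynomial.X + Polynomial.C d) (a := -(d * b')) (by
      have hF : 2 * c * (-(d * b')) ^ 2 + b * (-(d * b')) + d = 2 * c * (d * b') ^ 2 := by
        linear_combination (-d) * hb'
      have hF' : 2 * c * (2 * (-(d * b'))) + b = 4 * c * (-(d * b')) + b := by ring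
      simp only [Polynomial.derivative_mul, Polynomial.derivative_C,
        Polynomial.derivative_X_pow, Polynomial.derivative_X, map_add, map_mul, map_pow,
        Polynomial.aeval_C, Polynomial.aeval_X, Algebra.algebraMap_self_apply, zero_mul,
        mul_zero, zero_add, mul_one, add_zero, Nat.cast_ofNat, Nat.add_one_sub_one, pow_one]
      rw [hF, hF', PadicInt.isUnit_iff.1 hderiv]
      simpa using hvalue)
  refine ⟨z, ?_⟩
  simp only [map_add, map_mul, map_pow, Polynomial.aeval_C, Polynomial.aeval_X,
    Algebra.algebraMap_self_apply] at hz
  linear_combination hz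

theorem Matrix.dotProduct_blockDiagonal'_mulVec {o R : Type*} [Fintype o] [DecidableEq o]
    [CommSemiring R] {m : o → Type*} [∀ i, Fintype (m i)] (M : ∀ i, Matrix (m i) (m i) R)
    (x y : (Σ i, m i) → R) :
    x ⬝ᵥ blockDiagonal' M *ᵥ y =
      ∑ i, (fun a => x ⟨i, a⟩) ⬝ᵥ M i *ᵥ (fun a => y ⟨i, a⟩) := by
  have hrow : ∀ i a, (blockDiagonal' M *ᵥ y) ⟨i, a⟩ = (M i *ᵥ fun b => y ⟨i, b⟩) a := by
    intro i a
    simp only [mulVec, dotProduct, Fintype.sum_sigma]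
    rw [Finset.sum_eq_single i]
    · simp [blockDiagonal'_apply_eq]
    · intro j _ hj
      exact Finset.sum_eq_zero fun b _ => by
        rw [blockDiagonal'_apply_ne _ _ _ hj.symm, zero_mul]
    · simp
  simp only [dotProduct, Fintype.sum_sigma, hrow]

/-- The vector supported on the block `i` with entries `y`. -/
def blockVec {o R : Type*} [DecidableEq o] [Zero R] {m : o → Type*} (i : o) (y : m i → R) :
    (Σ i, m i) → R :=
  fun k => (Pi.single i y : ∀ j, m j → R) k.1 k.2

section blockVec

variable {o R : Type*} [DecidableEq o] {m : o → Type*}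

theorem blockVec_same [Zero R] (i : o) (y : m i → R) (a : m i) : blockVec i y ⟨i, a⟩ = y a := by
  simp [blockVec]

theorem blockVec_of_ne [Zero R] {i j : o} (h : j ≠ i) (y : m i → R) (a : m j) :
    blockVec i y ⟨j, a⟩ = 0 := by
  simp [blockVec, Pi.single_eq_of_ne h]

theorem dotProduct_blockDiagonal'_mulVec_blockVec [CommSemiring R] [Fintype o]
    [∀ i, Fintype (m i)] (M : ∀ i, Matrix (m i) (m i) R) (i : o) (x : (Σ i, m i) → R)
    (y : m i → R) :
    x ⬝ᵥ blockDiagonal' M *ᵥ blockVec i y = (fun a => x ⟨i, a⟩) ⬝ᵥ M i *ᵥ y := by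
  rw [dotProduct_blockDiagonal'_mulVec, Finset.sum_eq_single i]
  · simp only [blockVec_same]
  · intro j _ hj
    have : (fun a => blockVec i y ⟨j, a⟩) = (0 : m j → R) := by
      ext a
      exact blockVec_of_ne hj y a
    rw [this]
    simp
  · simp

end blockVec

/-- If the matrix `U` is invertible, then every coordinate of `w` is a value of `w ⬝ᵥ U *ᵥ ·`. -/
theorem Matrix.exists_dotProduct_mulVec_eq {ι R : Type*} [Fintype ι] [DecidableEq ι] [CommRing R]
    {U : Matrix ι ι R} (hU : IsUnit U.det) (w : ι → R) (a : ι) :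
    ∃ y, w ⬝ᵥ U *ᵥ y = w a :=
  ⟨U⁻¹ *ᵥ Pi.single a 1, by rw [mulVec_mulVec, mul_nonsing_inv U hU, one_mulVec, dotProduct_single_one]⟩

theorem Matrix.IsSymm.dotProduct_mulVec_comm {ι R : Type*} [Fintype ι] [CommSemiring R]
    {G : Matrix ι ι R} (hG : G.IsSymm) (x y : ι → R) : x ⬝ᵥ G *ᵥ y = y ⬝ᵥ G *ᵥ x := by
  rw [dotProduct_mulVec, ← mulVec_transpose, hG.eq, dotProduct_comm]

theorem Matrix.IsSymm.dotProduct_mulVec_add_smul {ι R : Type*} [Fintype ι] [CommSemiring R]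
    {G : Matrix ι ι R} (hG : G.IsSymm) (x y : ι → R) (t : R) :
    (x + t • y) ⬝ᵥ G *ᵥ (x + t • y) =
      x ⬝ᵥ G *ᵥ x + 2 * t * (x ⬝ᵥ G *ᵥ y) + t ^ 2 * (y ⬝ᵥ G *ᵥ y) := by
  simp only [mulVec_add, mulVec_smul, add_dotProduct, dotProduct_add, smul_dotProduct,
    dotProduct_smul, smul_eq_mul, hG.dotProduct_mulVec_comm y x]
  ring

/-- A vector of small norm pairing with another to a value of large scale
yields an isotropic combination. -/
theorem exists_isotropic_add_smul {ι : Type*} [Fintype ι] {G : Matrix ι ι ℤ_[2]} (hG : G.IsSymm)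
    (x y : ι → ℤ_[2]) (e : ℕ) {b c d : ℤ_[2]} (hb : IsUnit b)
    (hxx : x ⬝ᵥ G *ᵥ x = 2 ^ (e + 3) * d) (hxy : x ⬝ᵥ G *ᵥ y = 2 ^ e * b)
    (hyy : y ⬝ᵥ G *ᵥ y = 2 ^ e * c) :
    ∃ t : ℤ_[2], (x + (4 * t) • y) ⬝ᵥ G *ᵥ (x + (4 * t) • y) = 0 := by
  obtain ⟨t, ht⟩ := PadicInt.exists_root_quadratic hb c d
  refine ⟨t, ?_⟩
  rw [hG.dotProduct_mulVec_add_smul, hxx, hxy, hyy]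
  linear_combination 2 ^ (e + 3) * ht

/-- Coordinates of a form over `ℤ₂` in an isometric space over `ℚ₂`. -/
theorem dotProduct_mulVec_eq_of_isometry {ι κ : Type*} [Fintype ι] [DecidableEq ι] [Fintype κ]
    {G : Matrix ι ι ℤ_[2]} {D : Matrix κ κ ℚ_[2]} {T : Matrix ι κ ℚ_[2]} {T' : Matrix κ ι ℚ_[2]}
    (hT : T * T' = 1) (hD : Tᵀ * G.map (fun x => (x : ℚ_[2])) * T = D) (x y : ι → ℤ_[2]) :
    (T' *ᵥ fun i => (x i : ℚ_[2])) ⬝ᵥ D *ᵥ (T' *ᵥ fun i => (y i : ℚ_[2])) =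
      ((x ⬝ᵥ G *ᵥ y : ℤ_[2]) : ℚ_[2]) := by
  have hleft : (T' *ᵥ fun i => (x i : ℚ_[2])) ᵥ* Tᵀ = fun i => (x i : ℚ_[2]) := by
    rw [vecMul_transpose, mulVec_mulVec, hT, one_mulVec]
  rw [← hD, ← mulVec_mulVec, ← mulVec_mulVec, mulVec_mulVec _ T, hT, one_mulVec,
    dotProduct_mulVec, hleft]
  simp [dotProduct, mulVec, PadicInt.coe_sum]

/-- Let `M = M₁ ⊥ ⋯ ⊥ M_{r+1}` be a Jordan splitting of a `ℤ₂`-lattice (each component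
`2^(e i)`-modular with strictly decreasing scales, i.e. strictly increasing `e`), with the last
component of scale and norm `2^(2s)ℤ₂` for some positive integer `s`.  Suppose the `ℚ₂`-space of
`M` is isometric to that of `𝔸 ⊥ ⟨1, -1⟩` and `M' = M₁ ⊥ ⋯ ⊥ M_r` is anisotropic.  Then no
integer congruent to `2^(2s+2)` modulo `2^(2s+3)` is primitively represented by `M`. -/
theorem no_primitive_value_cong
    (r s : ℕ) (hs : 1 ≤ s)
    (n : Fin (r + 1) → ℕ) (hn : ∀ i, 1 ≤ n i)
    (e : Fin (r + 1) → ℕ) (hmono : StrictMono e) (helast : e (Fin.last r) = 2 * s)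
    (M : ∀ i, Matrix (Fin (n i)) (Fin (n i)) ℤ_[2])
    (hsymm : ∀ i, (M i).IsSymm)
    (hmod : ∀ i, ∃ U : Matrix (Fin (n i)) (Fin (n i)) ℤ_[2],
      IsUnit U.det ∧ M i = (2 ^ e i : ℤ_[2]) • U)
    (hnorm : ∃ a : Fin (n (Fin.last r)),
      (M (Fin.last r) a a).valuation = 2 * (s : ℤ))
    (hspace : ∃ (T : Matrix (Σ i, Fin (n i)) (Fin 4) ℚ_[2])
        (T' : Matrix (Fin 4) (Σ i, Fin (n i)) ℚ_[2]),
      T * T' = 1 ∧ T' * T = 1 ∧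
        Tᵀ * (Matrix.blockDiagonal' M).map (fun x => (x : ℚ_[2])) * T =
          !![2, 1, 0, 0; 1, 2, 0, 0; 0, 0, 1, 0; 0, 0, 0, -1])
    (hanis : ∀ v : (Σ i, Fin (n i)) → ℤ_[2],
      (∀ a : Fin (n (Fin.last r)), v ⟨Fin.last r, a⟩ = 0) →
        v ⬝ᵥ (Matrix.blockDiagonal' M).mulVec v = 0 → v = 0) :
    ∀ α : ℤ_[2], (∃ β : ℤ_[2], α = 2 ^ (2 * s + 2) + 2 ^ (2 * s + 3) * β) →
      ¬ ∃ v : (Σ i, Fin (n i)) → ℤ_[2],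
        (∃ idx, IsUnit (v idx)) ∧ v ⬝ᵥ (Matrix.blockDiagonal' M).mulVec v = α := by
  rintro α ⟨β, rfl⟩ ⟨v, ⟨idx, hidx⟩, hv⟩
  obtain ⟨T, T', hT, -, hD⟩ := hspace
  choose U hU hMU using hmod
  have hform : ∀ i (x y : Fin (n i) → ℤ_[2]), x ⬝ᵥ M i *ᵥ y = 2 ^ e i * (x ⬝ᵥ U i *ᵥ y) := by
    intro i x y
    rw [hMU i, smul_mulVec, dotProduct_smul, smul_eq_mul]
  have hGsymm : (blockDiagonal' M).IsSymm := by
    rw [IsSymm, blockDiagonal'_transpose]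
    exact congrArg blockDiagonal' (funext hsymm)
  have hUcomm : ∀ i (x y : Fin (n i) → ℤ_[2]), x ⬝ᵥ U i *ᵥ y = y ⬝ᵥ U i *ᵥ x := by
    intro i x y
    have h := (hsymm i).dotProduct_mulVec_comm x y
    rw [hform, hform] at h
    exact mul_left_cancel₀ (pow_ne_zero _ two_ne_zero) h
  have hodd : IsUnit (1 + 2 * β) := by
    rw [PadicInt.isUnit_iff_toZMod_eq_one]
    simp [PadicInt.toZMod_two_eq_zero]
  set w : Fin (n (Fin.last r)) → ℤ_[2] := fun a => v ⟨Fin.last r, a⟩ with hw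
  -- Pairings with vectors of unit norm in the (scaled) last component are even.
  have hpair : ∀ f, IsUnit (f ⬝ᵥ U (Fin.last r) *ᵥ f) → ¬ IsUnit (w ⬝ᵥ U (Fin.last r) *ᵥ f) := by
    intro f hf hwf
    refine not_odd_plane_in_A_perp_hyperbolic s hf hwf hodd
      (T' *ᵥ fun i => ((blockVec (Fin.last r) f i : ℤ_[2]) : ℚ_[2])) (T' *ᵥ fun i => (v i : ℚ_[2])) ?_ ?_ ?_
    · rw [dotProduct_mulVec_eq_of_isometry hT hD, dotProduct_blockDiagonal'_mulVec_blockVec]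
      simp only [blockVec_same, hform, helast]
      push_cast
      rfl
    · rw [dotProduct_mulVec_eq_of_isometry hT hD, hGsymm.dotProduct_mulVec_comm,
        dotProduct_blockDiagonal'_mulVec_blockVec, hform, helast]
      push_cast
      rfl
    · rw [dotProduct_mulVec_eq_of_isometry hT hD, hv]
      have h2 : ((2 : ℤ_[2]) : ℚ_[2]) = 2 := rfl
      push_cast [h2]
      ring
  obtain ⟨a, ha⟩ := hnorm
  have hUa : IsUnit (U (Fin.last r) a a) := by
    have hval : (M (Fin.last r) a a).valuation = 2 * s := by exact_mod_cast ha
    have hne : M (Fin.last r) a a ≠ 0 := by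
      intro h0
      rw [h0, PadicInt.valuation_zero] at hval
      omega
    have hspec := PadicInt.unitCoeff_spec hne
    have hentry : M (Fin.last r) a a = 2 ^ (2 * s) * U (Fin.last r) a a := by
      rw [hMU, Matrix.smul_apply, smul_eq_mul, helast]
    rw [hval, mul_comm] at hspec
    rw [mul_left_cancel₀ (pow_ne_zero _ (two_ne_zero (α := ℤ_[2]))) (hentry.symm.trans hspec)]
    exact Units.isUnit _
  have hpairs : ∀ f, ¬ IsUnit (w ⬝ᵥ U (Fin.last r) *ᵥ f) := by
    intro f hwf
    by_cases hf : IsUnit (f ⬝ᵥ U (Fin.last r) *ᵥ f)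
    · exact hpair f hf hwf
    have hg : IsUnit ((Pi.single a 1 : Fin (n (Fin.last r)) → ℤ_[2]) ⬝ᵥ
        U (Fin.last r) *ᵥ Pi.single a 1) := by
      simpa using hUa
    have hwg := hpair _ hg
    set g : Fin (n (Fin.last r)) → ℤ_[2] := Pi.single a 1
    obtain ⟨c, hc⟩ := PadicInt.exists_two_mul_of_not_isUnit hf
    obtain ⟨d, hd⟩ := PadicInt.exists_two_mul_of_not_isUnit hwg
    refine hpair (g + f) ?_ ?_
    · have hsum : (g + f) ⬝ᵥ U (Fin.last r) *ᵥ (g + f) =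
          g ⬝ᵥ U (Fin.last r) *ᵥ g + 2 * (g ⬝ᵥ U (Fin.last r) *ᵥ f + c) := by
        simp only [mulVec_add, add_dotProduct, dotProduct_add, hc, hUcomm _ f g]
        ring
      rw [PadicInt.isUnit_iff_toZMod_eq_one] at hg ⊢
      simp [hsum, hg, PadicInt.toZMod_two_eq_zero]
    · rw [mulVec_add, dotProduct_add, hd]
      rw [PadicInt.isUnit_iff_toZMod_eq_one] at hwf ⊢
      simp [hwf, PadicInt.toZMod_two_eq_zero]
  have hweven : ∀ b, ∃ c, w b = 2 * c := by
    intro b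
    obtain ⟨y, hy⟩ := exists_dotProduct_mulVec_eq (hU (Fin.last r)) w b
    exact PadicInt.exists_two_mul_of_not_isUnit (hy ▸ hpairs y)
  choose w' hw' using hweven
  obtain ⟨i, b⟩ := idx
  have hi : i ≠ Fin.last r := by
    rintro rfl
    obtain ⟨y, hy⟩ := exists_dotProduct_mulVec_eq (hU (Fin.last r)) w b
    exact hpairs y (hy ▸ hidx)
  have hei : e i + 1 ≤ 2 * s := by
    have := hmono (lt_of_le_of_ne (Fin.le_last i) hi)
    omega
  obtain ⟨y, hy⟩ := exists_dotProduct_mulVec_eq (hU i) (fun a => v ⟨i, a⟩) b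
  -- The part of `v` away from the last component.
  set x : (Σ i, Fin (n i)) → ℤ_[2] := v + (-1 : ℤ_[2]) • blockVec (Fin.last r) w with hx
  have hxlast : ∀ a, x ⟨Fin.last r, a⟩ = 0 := by
    intro a
    simp [hx, blockVec_same, hw]
  have hxne : ∀ j, j ≠ Fin.last r → ∀ a, x ⟨j, a⟩ = v ⟨j, a⟩ := by
    intro j hj a
    simp [hx, blockVec_of_ne hj]
  obtain ⟨k, hk⟩ : ∃ k, 2 * s = e i + 1 + k := ⟨_, (Nat.add_sub_cancel' hei).symm⟩
  have hxx : x ⬝ᵥ blockDiagonal' M *ᵥ x =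
      2 ^ (e i + 3) * (2 ^ k * (1 + 2 * β - w' ⬝ᵥ U (Fin.last r) *ᵥ w')) := by
    have hww : w = (2 : ℤ_[2]) • w' := by
      ext1 a
      simp [hw' a]
    rw [hx, hGsymm.dotProduct_mulVec_add_smul, hv, dotProduct_blockDiagonal'_mulVec_blockVec,
      dotProduct_blockDiagonal'_mulVec_blockVec]
    simp only [blockVec_same, hform, helast]
    rw [← hw]
    change _ + _ + _ * (_ * (w ⬝ᵥ _ *ᵥ w)) = _
    rw [hww]
    simp only [mulVec_smul, smul_dotProduct, dotProduct_smul, smul_eq_mul, hk]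
    ring
  have hxy : x ⬝ᵥ blockDiagonal' M *ᵥ blockVec i y = 2 ^ e i * v ⟨i, b⟩ := by
    rw [dotProduct_blockDiagonal'_mulVec_blockVec, hform]
    simp only [hxne i hi, hy]
  have hyy : blockVec i y ⬝ᵥ blockDiagonal' M *ᵥ blockVec i y = 2 ^ e i * (y ⬝ᵥ U i *ᵥ y) := by
    rw [dotProduct_blockDiagonal'_mulVec_blockVec, hform]
    simp only [blockVec_same]
  obtain ⟨t, ht⟩ := exists_isotropic_add_smul hGsymm x (blockVec i y) (e i) hidx hxx hxy hyy
  have hzero := hanis _ (fun a => by simp [hxlast, blockVec_of_ne hi.symm]) ht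
  have hcoord := congrFun hzero ⟨i, b⟩
  simp only [Pi.add_apply, Pi.smul_apply, smul_eq_mul, Pi.zero_apply, hxne i hi,
    blockVec_same] at hcoord
  have heq : v ⟨i, b⟩ = 2 * (-(2 * t * y b)) := by linear_combination hcoord
  rw [PadicInt.isUnit_iff_toZMod_eq_one, heq] at hidx
  simp [PadicInt.toZMod_two_eq_zero] at hidx
end
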